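/- Let X be a nonempty set and let E : F(X) → [0,∞] be convex with E(0) = 0 and lower semicontinuous with respect to pointwise convergence. Then the following are equivalent: (i) every normal contraction operates on E; (ii) for every α > 0 the normal contraction C_α(t) = t ∧ α operates on E; (iii) for every β ∈ ℝ the normal contraction D_β(t) = |t − β| − |β| operates on E. If moreover E is positively p-homogeneous for some 1 ≤ p < ∞, these are further equivalent to: (iv) C_1(t) = t ∧ 1 operates on E; (v) D_1(t) = |t − 1| − 1 operates on E. -/

import Mathlib

open scoped ENNReal NNReal

noncomputable section

/-- A `[0,∞]`-valued functional on a real vector space is convex. -/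
def ConvexENNReal {W : Type*} [AddCommGroup W] [Module ℝ W] (ρ : W → ℝ≥0∞) : Prop :=
  ∀ (x y : W) (a b : ℝ), 0 ≤ a → 0 ≤ b → a + b = 1 →
    ρ (a • x + b • y) ≤ ENNReal.ofReal a * ρ x + ENNReal.ofReal b * ρ y

/-- The modular cone `M(ρ) = {λ • x : λ ≥ 0, ρ x < ∞}`. -/
def modularCone {W : Type*} [AddCommGroup W] [Module ℝ W] (ρ : W → ℝ≥0∞) : Set W :=
  {x | ∃ (lam : ℝ) (y : W), 0 ≤ lam ∧ ρ y ≠ ⊤ ∧ x = lam • y}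

/-- The Luxemburg functional `‖x‖_L = inf {λ > 0 : ρ (λ⁻¹ x) ≤ 1}` (equal to `∞` outside
the modular cone, where no admissible `λ` exists). -/
noncomputable def luxemburg {W : Type*} [AddCommGroup W] [Module ℝ W]
    (ρ : W → ℝ≥0∞) (x : W) : ℝ≥0∞ :=
  ⨅ (lam : ℝ) (_ : 0 < lam) (_ : ρ (lam⁻¹ • x) ≤ 1), ENNReal.ofReal lam

/-- A normal contraction `C` operates on `E` (`E` is compatible with `C`). -/
def Operates {X : Type*} (C : ℝ → ℝ) (E : (X → ℝ) → ℝ≥0∞) : Prop :=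
  ∀ f g : X → ℝ, E (f + C ∘ g) + E (f - C ∘ g) ≤ E (f + g) + E (f - g)

/-- `ρ` is positively `p`-homogeneous: `ρ (λ • x) = λ^p • ρ x` for `λ ≥ 0`. -/
def PosHomogeneous {W : Type*} [AddCommGroup W] [Module ℝ W] (p : ℝ) (ρ : W → ℝ≥0∞) : Prop :=
  ∀ (lam : ℝ), 0 ≤ lam → ∀ x : W, ρ (lam • x) = ENNReal.ofReal (lam ^ p) * ρ x

theorem aux_comp {S T : Type*} [TopologicalSpace S] [TopologicalSpace T] {F : T → ℝ≥0∞}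
    (hF : LowerSemicontinuous F) {u : S → T} (hu : Continuous u) :
    LowerSemicontinuous (fun s => F (u s)) :=
  fun x y hy => hu.continuousAt.eventually (hF (u x) y hy)

/-- limits under lower semicontinuity -/
theorem aux_lsc_le {T : Type*} [TopologicalSpace T] {F : T → ℝ≥0∞} (hF : LowerSemicontinuous F)
    {u : ℕ → T} {x : T} {R : ℝ≥0∞} (hu : Filter.Tendsto u Filter.atTop (nhds x))
    (h : ∀ n, F (u n) ≤ R) : F x ≤ R := by
  have hc : IsClosed (F ⁻¹' Set.Iic R) := hF.isClosed_preimage R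
  exact hc.mem_of_tendsto hu (Filter.Eventually.of_forall h)

theorem aux_sum_lsc {X : Type*} {E : (X → ℝ) → ℝ≥0∞} (hlsc : LowerSemicontinuous E) {T : Type*}
    [TopologicalSpace T] {u v : T → X → ℝ} (hu : Continuous u) (hv : Continuous v) :
    LowerSemicontinuous (fun t => E (u t) + E (v t)) :=
  LowerSemicontinuous.add (aux_comp hlsc hu) (aux_comp hlsc hv)

theorem aux_operates_lim {X : Type*} {E : (X → ℝ) → ℝ≥0∞} (hlsc : LowerSemicontinuous E)
    {C : ℕ → ℝ → ℝ} {D : ℝ → ℝ} (hC : ∀ n, Operates (C n) E)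
    (hlim : ∀ t, Filter.Tendsto (fun n => C n t) Filter.atTop (nhds (D t))) : Operates D E := by
  intro f g
  have h1 : LowerSemicontinuous (fun w : X → ℝ => E (f + w) + E (f - w)) :=
    aux_sum_lsc hlsc (by fun_prop) (by fun_prop)
  refine aux_lsc_le h1 (u := fun n => C n ∘ g) ?_ (fun n => hC n f g)
  rw [tendsto_pi_nhds]
  intro x
  exact hlim (g x)

/-- The basic supermodularity condition. -/
def AuxGood {X : Type*} (E : (X → ℝ) → ℝ≥0∞) : Prop :=
  ∀ (c : ℝ) (k w y : X → ℝ), 0 ≤ c → (∀ x, k x ≤ c) → (∀ x, 0 ≤ w x) →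
    (∀ x, w x = 0 ∨ k x = c) → E (y + k) + E (y + w) ≤ E (y + k + w) + E y

theorem aux_good_of_D {X : Type*} {E : (X → ℝ) → ℝ≥0∞}
    (h : ∀ β : ℝ, 0 ≤ β → Operates (fun s => |s - β| - |β|) E) : AuxGood E := by
  intro c k w y hc hk hw hs
  have key := h (c / 2) (by linarith) (y + (1/2 : ℝ) • k + (1/2 : ℝ) • w)
    ((1/2 : ℝ) • k + (1/2 : ℝ) • w)
  have e : ((fun s => |s - c / 2| - |c / 2|) ∘ ((1/2 : ℝ) • k + (1/2 : ℝ) • w))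
      = (1/2 : ℝ) • w - (1/2 : ℝ) • k := by
    funext x
    simp only [Function.comp, Pi.add_apply, Pi.sub_apply, Pi.smul_apply, smul_eq_mul]
    rw [abs_of_nonneg (show (0:ℝ) ≤ c / 2 by linarith)]
    have := hk x
    have := hw x
    rcases hs x with h1 | h1
    · rw [h1, abs_of_nonpos (by linarith)]; ring
    · rw [h1, abs_of_nonneg (by linarith)]; ring
  rw [e] at key
  have e1 : y + (1/2 : ℝ) • k + (1/2 : ℝ) • w + ((1/2 : ℝ) • w - (1/2 : ℝ) • k) = y + w := by
    module
  have e2 : y + (1/2 : ℝ) • k + (1/2 : ℝ) • w - ((1/2 : ℝ) • w - (1/2 : ℝ) • k) = y + k := by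
    module
  have e3 : y + (1/2 : ℝ) • k + (1/2 : ℝ) • w + ((1/2 : ℝ) • k + (1/2 : ℝ) • w)
      = y + k + w := by
    module
  have e4 : y + (1/2 : ℝ) • k + (1/2 : ℝ) • w - ((1/2 : ℝ) • k + (1/2 : ℝ) • w) = y := by
    module
  rw [e1, e2, e3, e4] at key
  rwa [add_comm (E (y + k))]

theorem aux_cancel {a b c : ℝ≥0∞} (hc : c ≠ ⊤) (h : a + c ≤ b + c) : a ≤ b :=
  (ENNReal.add_le_add_iff_right hc).1 h

theorem aux_swap_dyadic {A B : ℝ → ℝ≥0∞}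
    (h : ∀ p q : ℝ, q ≤ p → A ((p + q) / 2) + B ((p + q) / 2) ≤ A p + B q) (n : ℕ) :
    ∀ p q : ℝ, q ≤ p →
      A (q + (p - q) / 2 ^ (n + 1)) + B (p - (p - q) / 2 ^ (n + 1)) ≤ A p + B q := by
  induction n with
  | zero =>
    intro p q hpq
    have := h p q hpq
    have e1 : q + (p - q) / 2 ^ (0 + 1) = (p + q) / 2 := by ring
    have e2 : p - (p - q) / 2 ^ (0 + 1) = (p + q) / 2 := by ring
    rwa [e1, e2]
  | succ n ih =>
    intro p q hpq
    by_cases htop : A p + B q = ⊤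
    · rw [htop]; exact le_top
    have hm := h p q hpq
    set m := (p + q) / 2 with hmdef
    set ε := (p - q) / 2 ^ (n + 1 + 1) with hε
    have hε0 : 0 ≤ ε := by
      have : 0 ≤ p - q := by linarith
      positivity
    have h1 := ih p m (by rw [hmdef]; linarith)
    have h2 := ih m q (by rw [hmdef]; linarith)
    have d1 : (p - m) / 2 ^ (n + 1) = ε := by
      rw [hmdef, hε]; field_simp; ring
    have d2 : (m - q) / 2 ^ (n + 1) = ε := by
      rw [hmdef, hε]; field_simp; ring
    rw [d1] at h1
    rw [d2] at h2
    have h3 := h (m + ε) (m - ε) (by linarith)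
    have d3 : (m + ε + (m - ε)) / 2 = m := by ring
    rw [d3] at h3
    have hfin : A m + B m ≠ ⊤ := ne_top_of_le_ne_top htop hm
    apply aux_cancel hfin
    calc A (q + ε) + B (p - ε) + (A m + B m)
        ≤ A (q + ε) + B (p - ε) + (A (m + ε) + B (m - ε)) := by gcongr
      _ = (A (m + ε) + B (p - ε)) + (A (q + ε) + B (m - ε)) := by ring
      _ ≤ (A p + B m) + (A m + B q) := add_le_add h1 h2
      _ = A p + B q + (A m + B m) := by ring

theorem aux_swap {A B : ℝ → ℝ≥0∞} (hA : LowerSemicontinuous A) (hB : LowerSemicontinuous B)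
    (h : ∀ p q : ℝ, q ≤ p → A ((p + q) / 2) + B ((p + q) / 2) ≤ A p + B q)
    (p q : ℝ) (hpq : q ≤ p) : A q + B p ≤ A p + B q := by
  have h1 : LowerSemicontinuous (fun s : ℝ => A (q + s) + B (p - s)) :=
    LowerSemicontinuous.add (aux_comp hA (by fun_prop)) (aux_comp hB (by fun_prop))
  have hu : Filter.Tendsto (fun n : ℕ => (p - q) / 2 ^ (n + 1)) Filter.atTop (nhds 0) := by
    have t1 : Filter.Tendsto (fun n : ℕ => (p - q) * (1 / 2 : ℝ) ^ n) Filter.atTop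
        (nhds ((p - q) * 0)) :=
      (tendsto_pow_atTop_nhds_zero_of_lt_one (by norm_num) (by norm_num)).const_mul _
    have t2 := (Filter.tendsto_add_atTop_iff_nat 1).2 t1
    rw [mul_zero] at t2
    refine t2.congr (fun n => ?_)
    rw [one_div, inv_pow]; rfl
  have := aux_lsc_le h1 hu (fun n => aux_swap_dyadic h n p q hpq)
  simpa using this

theorem aux_good_of_C {X : Type*} {E : (X → ℝ) → ℝ≥0∞} (hlsc : LowerSemicontinuous E)
    (h : ∀ α : ℝ, 0 ≤ α → Operates (fun s => min s α) E) : AuxGood E := by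
  intro c k w y hc hk hw hs
  have hA : LowerSemicontinuous (fun s : ℝ => E (y + k + s • w)) :=
    aux_comp hlsc (by fun_prop)
  have hB : LowerSemicontinuous (fun s : ℝ => E (y + s • w)) :=
    aux_comp hlsc (by fun_prop)
  have key := aux_swap hA hB ?_ 1 0 zero_le_one
  · simpa using key
  intro p q hpq
  have key := h (c / 2) (by linarith) (y + (1/2 : ℝ) • k + ((p + q) / 2) • w)
    ((1/2 : ℝ) • k + ((p - q) / 2) • w)
  have e : ((fun s => min s (c / 2)) ∘ ((1/2 : ℝ) • k + ((p - q) / 2) • w))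
      = (1/2 : ℝ) • k := by
    funext x
    simp only [Function.comp, Pi.add_apply, Pi.smul_apply, smul_eq_mul]
    have := hk x
    have h2 : 0 ≤ (p - q) / 2 * w x := mul_nonneg (by linarith) (hw x)
    rcases hs x with h1 | h1
    · rw [h1, min_eq_left (by linarith)]; ring
    · rw [h1, min_eq_right (by linarith)]; ring
  rw [e] at key
  have e1 : y + (1/2 : ℝ) • k + ((p + q) / 2) • w + (1/2 : ℝ) • k
      = y + k + ((p + q) / 2) • w := by module
  have e2 : y + (1/2 : ℝ) • k + ((p + q) / 2) • w - (1/2 : ℝ) • k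
      = y + ((p + q) / 2) • w := by module
  have e3 : y + (1/2 : ℝ) • k + ((p + q) / 2) • w + ((1/2 : ℝ) • k + ((p - q) / 2) • w)
      = y + k + p • w := by module
  have e4 : y + (1/2 : ℝ) • k + ((p + q) / 2) • w - ((1/2 : ℝ) • k + ((p - q) / 2) • w)
      = y + q • w := by module
  rw [e1, e2, e3, e4] at key
  exact key

/-- Normal contraction. -/
def AuxNC (C : ℝ → ℝ) : Prop := C 0 = 0 ∧ ∀ s t, |C s - C t| ≤ |s - t|

/-- Gluing at level `c`. -/
def auxGlue (c : ℝ) (K C : ℝ → ℝ) : ℝ → ℝ := fun t => K (min t c) + C (max (t - c) 0)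

theorem auxGlue_nc {c : ℝ} (hc : 0 ≤ c) {K C : ℝ → ℝ} (hK : AuxNC K) (hC : AuxNC C) :
    AuxNC (auxGlue c K C) := by
  constructor
  · simp [auxGlue, min_eq_left hc, hK.1, hC.1, max_eq_right, hc]
  · intro s t
    have h1 := hK.2 (min s c) (min t c)
    have h2 := hC.2 (max (s - c) 0) (max (t - c) 0)
    have h3 : |min s c - min t c| + |max (s - c) 0 - max (t - c) 0| ≤ |s - t| := by
      rcases le_total s c with a | a <;> rcases le_total t c with b | b
      · simp [min_eq_left a, min_eq_left b, max_eq_right (sub_nonpos.2 a),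
          max_eq_right (sub_nonpos.2 b)]
      · rw [min_eq_left a, min_eq_right b, max_eq_right (sub_nonpos.2 a),
          max_eq_left (sub_nonneg.2 b), abs_of_nonpos (by linarith), abs_of_nonpos (by linarith),
          abs_of_nonpos (by linarith)]
        linarith
      · rw [min_eq_right a, min_eq_left b, max_eq_left (sub_nonneg.2 a),
          max_eq_right (sub_nonpos.2 b), abs_of_nonneg (by linarith), abs_of_nonneg (by linarith),
          abs_of_nonneg (by linarith)]
        linarith
      · simp [min_eq_right a, min_eq_right b, max_eq_left (sub_nonneg.2 a),
          max_eq_left (sub_nonneg.2 b)]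
    have h4 : auxGlue c K C s - auxGlue c K C t = (K (min s c) - K (min t c)) +
        (C (max (s - c) 0) - C (max (t - c) 0)) := by
      simp only [auxGlue]; ring
    rw [h4]
    exact (abs_add_le _ _).trans (by linarith)

/-- `Operates` in terms of the splitting `2 g = P + M`. -/
theorem aux_operates_split {X : Type*} {E : (X → ℝ) → ℝ≥0∞} {C : ℝ → ℝ} (h : Operates C E)
    (g y : X → ℝ) :
    E (y + (g + C ∘ g)) + E (y + (g - C ∘ g)) ≤ E (y + (2 : ℝ) • g) + E y := by
  have := h (y + g) g
  have e1 : y + g + C ∘ g = y + (g + C ∘ g) := by module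
  have e2 : y + g - C ∘ g = y + (g - C ∘ g) := by module
  have e3 : y + g + g = y + (2 : ℝ) • g := by module
  have e4 : y + g - g = y := by module
  rwa [e1, e2, e3, e4] at this

theorem auxGlue_operates {X : Type*} {E : (X → ℝ) → ℝ≥0∞} (hG : AuxGood E)
    {c : ℝ} (hc : 0 ≤ c) {K C : ℝ → ℝ} (hK : AuxNC K) (hC : AuxNC C)
    (oK : Operates K E) (oC : Operates C E) : Operates (auxGlue c K C) E := by
  intro f g
  by_cases htop : E (f + g) + E (f - g) = ⊤
  · rw [htop]; exact le_top
  set k : X → ℝ := fun x => min (g x) c with hk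
  set r : X → ℝ := fun x => max (g x - c) 0 with hr
  have hgkr : g = k + r := by
    funext x
    simp only [hk, hr, Pi.add_apply]
    rcases le_total (g x) c with a | a
    · rw [min_eq_left a, max_eq_right (by linarith)]; ring
    · rw [min_eq_right a, max_eq_left (by linarith)]; ring
  have hCg : auxGlue c K C ∘ g = K ∘ k + C ∘ r := rfl
  set y : X → ℝ := f - g with hy
  have hkc : ∀ x, k x ≤ c := fun x => min_le_right _ _
  have hr0 : ∀ x, 0 ≤ r x := fun x => le_max_right _ _
  have hs : ∀ x, r x = 0 ∨ k x = c := by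
    intro x
    rcases le_total (g x) c with a | a
    · left; exact max_eq_right (by linarith)
    · right; exact min_eq_right a
  set Pk := k + K ∘ k with hPk
  set Mk := k - K ∘ k with hMk
  set Pr := r + C ∘ r with hPr
  set Mr := r - C ∘ r with hMr
  have hCr : ∀ x, |C (r x)| ≤ r x := by
    intro x
    have := hC.2 (r x) 0
    rw [hC.1, sub_zero, sub_zero, abs_of_nonneg (hr0 x)] at this
    exact this
  have hPr0 : ∀ x, 0 ≤ Pr x := fun x => by
    have := abs_le.1 (hCr x)
    simp only [hPr, Pi.add_apply, Function.comp]; linarith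
  have hMr0 : ∀ x, 0 ≤ Mr x := fun x => by
    have := abs_le.1 (hCr x)
    simp only [hMr, Pi.sub_apply, Function.comp]; linarith
  have hKc : |K c| ≤ c := by
    have := hK.2 c 0
    rwa [hK.1, sub_zero, sub_zero, abs_of_nonneg hc] at this
  have hKk : ∀ x, |K (k x) - K c| ≤ c - k x := by
    intro x
    have := hK.2 (k x) c
    rwa [abs_of_nonpos (show k x - c ≤ 0 by linarith [hkc x]), neg_sub] at this
  have hPkc : ∀ x, Pk x ≤ c + K c := fun x => by
    have := abs_le.1 (hKk x)
    simp only [hPk, Pi.add_apply, Function.comp]; linarith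
  have hMkc : ∀ x, Mk x ≤ c - K c := fun x => by
    have := abs_le.1 (hKk x)
    simp only [hMk, Pi.sub_apply, Function.comp]; linarith
  have hsP : ∀ x, Mr x = 0 ∨ Pk x = c + K c := by
    intro x
    rcases hs x with h | h
    · left; simp [hMr, h, hC.1]
    · right; simp [hPk, h]
  have hsM : ∀ x, Pr x = 0 ∨ Mk x = c - K c := by
    intro x
    rcases hs x with h | h
    · left; simp [hPr, h, hC.1]
    · right; simp [hMk, h]
  have hKc' := abs_le.1 hKc
  have i0 := hG (2 * c) ((2 : ℝ) • k) ((2 : ℝ) • r) y (by linarith)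
    (fun x => by simpa using hkc x) (fun x => by simpa using hr0 x)
    (fun x => by simpa using hs x)
  have ia := aux_operates_split oK k y
  have ib := aux_operates_split oC r (y + (2 : ℝ) • k)
  have ic := hG (c - K c) Mk Pr (y + Pk) (by linarith) hMkc hPr0 hsM
  have id' := hG (c + K c) Pk Mr (y + Mk) (by linarith) hPkc hMr0 hsP
  have e11 : y + Pk + Mk = y + (2 : ℝ) • k := by rw [hPk, hMk]; module
  have e11' : y + Mk + Pk = y + (2 : ℝ) • k := by rw [hPk, hMk]; module
  have e22 : y + (2 : ℝ) • k + (2 : ℝ) • r = f + g := by rw [hy, hgkr]; module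
  have e20 : f + auxGlue c K C ∘ g = y + Pk + Pr := by
    rw [hCg, hy, hPk, hPr, hgkr]; module
  have e02 : f - auxGlue c K C ∘ g = y + Mk + Mr := by
    rw [hCg, hy, hMk, hMr, hgkr]; module
  rw [e22] at i0 ib
  rw [e11] at ic
  rw [e11'] at id'
  rw [e20, e02]
  rw [← hPk, ← hMk] at ia
  rw [← hPr, ← hMr] at ib
  have f0 := ne_top_of_le_ne_top htop i0
  have fin11 : E (y + (2 : ℝ) • k) ≠ ⊤ := (ENNReal.add_ne_top.1 f0).1
  have fin22 : E (f + g) ≠ ⊤ := (ENNReal.add_ne_top.1 htop).1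
  have fin00 : E y ≠ ⊤ := (ENNReal.add_ne_top.1 htop).2
  have fa := ne_top_of_le_ne_top (ENNReal.add_ne_top.2 ⟨fin11, fin00⟩) ia
  have fb := ne_top_of_le_ne_top (ENNReal.add_ne_top.2 ⟨fin22, fin11⟩) ib
  generalize E (y + (2 : ℝ) • k) = x11 at *
  generalize E (y + Pk + Pr) = x20 at *
  generalize E (y + Mk + Mr) = x02 at *
  generalize E (y + Pk) = x10 at *
  generalize E (y + Mk) = x01 at *
  generalize E (y + (2 : ℝ) • k + Pr) = x21 at *
  generalize E (y + (2 : ℝ) • k + Mr) = x12 at *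
  generalize E (f + g) = x22 at *
  generalize E y = x00 at *
  have hfin : (x10 + x01) + (x21 + x12) + (x11 + x11) ≠ ⊤ := by
    simp only [ne_eq, ENNReal.add_eq_top, not_or] at fa fb fin11 ⊢
    tauto
  apply aux_cancel hfin
  calc x20 + x02 + ((x10 + x01) + (x21 + x12) + (x11 + x11))
      = (x10 + x01) + (x21 + x12) + (x11 + x20) + (x11 + x02) := by ring
    _ ≤ (x11 + x00) + (x22 + x11) + (x21 + x10) + (x12 + x01) := by
        refine add_le_add (add_le_add (add_le_add ia ib) ?_) ?_
        · refine ic.trans_eq' ?_; rfl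
        · exact id'
    _ = x22 + x00 + ((x10 + x01) + (x21 + x12) + (x11 + x11)) := by ring

theorem aux_smul_operates {X : Type*} {E : (X → ℝ) → ℝ≥0∞} (hconv : ConvexENNReal E)
    {l : ℝ} (hl : |l| ≤ 1) : Operates (fun t => l * t) E := by
  intro f g
  have hl' := abs_le.1 hl
  have h1 := hconv (f + g) (f - g) ((1 + l) / 2) ((1 - l) / 2) (by linarith) (by linarith)
    (by ring)
  have h2 := hconv (f + g) (f - g) ((1 - l) / 2) ((1 + l) / 2) (by linarith) (by linarith)
    (by ring)
  have e0 : (fun t => l * t) ∘ g = l • g := rfl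
  have e1 : ((1 + l) / 2) • (f + g) + ((1 - l) / 2) • (f - g) = f + l • g := by module
  have e2 : ((1 - l) / 2) • (f + g) + ((1 + l) / 2) • (f - g) = f - l • g := by module
  rw [e1] at h1
  rw [e2] at h2
  rw [e0]
  have e3 : ENNReal.ofReal ((1 + l) / 2) + ENNReal.ofReal ((1 - l) / 2) = 1 := by
    rw [← ENNReal.ofReal_add (by linarith) (by linarith)]
    rw [show (1 + l) / 2 + (1 - l) / 2 = 1 by ring, ENNReal.ofReal_one]
  generalize ENNReal.ofReal ((1 + l) / 2) = a at *
  generalize ENNReal.ofReal ((1 - l) / 2) = b at *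
  calc _ ≤ _ := add_le_add h1 h2
    _ = (a + b) * E (f + g) + (a + b) * E (f - g) := by ring
    _ = _ := by rw [e3, one_mul, one_mul]

theorem aux_smul_nc {l : ℝ} (hl : |l| ≤ 1) : AuxNC (fun t => l * t) := by
  refine ⟨by simp, fun s t => ?_⟩
  rw [← mul_sub, abs_mul]
  exact mul_le_of_le_one_left (abs_nonneg _) hl

theorem aux_refl_nc {C : ℝ → ℝ} (hC : AuxNC C) : AuxNC (fun t => C (-t)) := by
  refine ⟨by simp [hC.1], fun s t => ?_⟩
  have := hC.2 (-s) (-t)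
  rwa [show -s - -t = -(s - t) by ring, abs_neg] at this

theorem aux_refl_operates {X : Type*} {E : (X → ℝ) → ℝ≥0∞} {C : ℝ → ℝ} (hC : Operates C E) :
    Operates (fun t => C (-t)) E := by
  intro f g
  have := hC f (-g)
  rw [show C ∘ (-g) = (fun t => C (-t)) ∘ g from rfl, sub_neg_eq_add, ← sub_eq_add_neg,
    add_comm (E (f - g))] at this
  exact this

theorem aux_interp {X : Type*} {E : (X → ℝ) → ℝ≥0∞} (hconv : ConvexENNReal E) (hG : AuxGood E)
    {δ : ℝ} (hδ : 0 < δ) (n : ℕ) : ∀ C : ℝ → ℝ, AuxNC C →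
    ∃ L : ℝ → ℝ, AuxNC L ∧ Operates L E ∧ ∀ i : ℕ, i ≤ n → L (i * δ) = C (i * δ) := by
  induction n with
  | zero =>
    intro C hC
    refine ⟨fun t => 0 * t, aux_smul_nc (by simp), aux_smul_operates hconv (by simp), ?_⟩
    intro i hi
    obtain rfl : i = 0 := by omega
    simp [hC.1]
  | succ n ih =>
    intro C hC
    obtain ⟨L, hL, oL, hi⟩ := ih (fun t => C (t + δ) - C δ) ⟨by simp, fun s t => by
      have := hC.2 (s + δ) (t + δ)
      rwa [add_sub_add_right_eq_sub, ← sub_sub_sub_cancel_right _ _ (C δ)] at this⟩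
    have hl : |C δ / δ| ≤ 1 := by
      have := hC.2 δ 0
      rw [hC.1, sub_zero, sub_zero] at this
      rw [abs_div]
      exact div_le_one_of_le₀ this (abs_nonneg _)
    refine ⟨auxGlue δ (fun t => C δ / δ * t) L, auxGlue_nc hδ.le (aux_smul_nc hl) hL,
      auxGlue_operates hG hδ.le (aux_smul_nc hl) hL (aux_smul_operates hconv hl) oL, ?_⟩
    intro i hin
    rcases i with _ | i
    · simp [auxGlue, hδ.le, hL.1, hC.1]
    · have h1 : δ ≤ ((i + 1 : ℕ) : ℝ) * δ := by
        push_cast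
        have : 0 ≤ (i : ℝ) * δ := by positivity
        linarith
      have h2 : ((i + 1 : ℕ) : ℝ) * δ - δ = i * δ := by push_cast; ring
      have h3 := hi i (by omega)
      simp only [auxGlue]
      rw [min_eq_right h1, h2, max_eq_left (by positivity), h3, div_mul_cancel₀ _ hδ.ne',
        show (i : ℝ) * δ + δ = ((i + 1 : ℕ) : ℝ) * δ by push_cast; ring]
      ring

theorem aux_close {C L : ℝ → ℝ} (hC : AuxNC C) (hL : AuxNC L) {δ : ℝ} (hδ : 0 < δ) {n : ℕ}
    (h : ∀ i : ℕ, i ≤ n → L (i * δ) = C (i * δ)) {t : ℝ} (ht0 : 0 ≤ t) (ht : t ≤ n * δ) :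
    |L t - C t| ≤ 2 * δ := by
  have hf := Nat.floor_le (div_nonneg ht0 hδ.le)
  have hf2 := Nat.lt_floor_add_one (t / δ)
  have hin : ⌊t / δ⌋₊ ≤ n := by
    apply Nat.floor_le_of_le
    rwa [div_le_iff₀ hδ]
  generalize ⌊t / δ⌋₊ = i at *
  rw [le_div_iff₀ hδ] at hf
  rw [div_lt_iff₀ hδ] at hf2
  have h1 := hL.2 t (i * δ)
  have h2 := hC.2 t (i * δ)
  rw [h i hin] at h1
  rw [abs_of_nonneg (by linarith : 0 ≤ t - i * δ)] at h1 h2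
  rw [abs_le] at *
  constructor <;> linarith

theorem aux_all {X : Type*} {E : (X → ℝ) → ℝ≥0∞} (hconv : ConvexENNReal E)
    (hlsc : LowerSemicontinuous E) (hG : AuxGood E) {C : ℝ → ℝ} (hC : AuxNC C) :
    Operates C E := by
  have step : ∀ n : ℕ, ∃ L : ℝ → ℝ, Operates L E ∧
      ∀ t, |t| ≤ (n + 1 : ℝ) → |L t - C t| ≤ 2 * (1 / ((n : ℝ) + 1)) := by
    intro n
    have hδ : (0 : ℝ) < 1 / ((n : ℝ) + 1) := by positivity
    have hN : (((n + 1) ^ 2 : ℕ) : ℝ) * (1 / ((n : ℝ) + 1)) = n + 1 := by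
      push_cast; field_simp
    obtain ⟨L1, n1, o1, i1⟩ := aux_interp hconv hG hδ ((n + 1) ^ 2) C hC
    obtain ⟨L2, n2, o2, i2⟩ := aux_interp hconv hG hδ ((n + 1) ^ 2) _ (aux_refl_nc hC)
    refine ⟨auxGlue 0 (fun t => L2 (-t)) L1, auxGlue_operates hG le_rfl (aux_refl_nc n2) n1
      (aux_refl_operates o2) o1, fun t ht => ?_⟩
    rcases le_total 0 t with h | h
    · have := aux_close hC n1 hδ i1 h (by rw [hN]; exact (le_abs_self t).trans ht)
      simpa [auxGlue, h, n2.1] using this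
    · have := aux_close (aux_refl_nc hC) n2 hδ i2 (neg_nonneg.2 h)
        (by rw [hN]; exact (neg_le_abs t).trans ht)
      simpa [auxGlue, h, n1.1] using this
  choose L oL hL using step
  refine aux_operates_lim hlsc oL (fun t => ?_)
  rw [tendsto_iff_dist_tendsto_zero]
  have hz : Filter.Tendsto (fun n : ℕ => 2 * (1 / ((n : ℝ) + 1))) Filter.atTop (nhds 0) := by
    simpa using (tendsto_one_div_add_atTop_nhds_zero_nat (𝕜 := ℝ)).const_mul 2
  refine squeeze_zero' (Filter.Eventually.of_forall fun _ => dist_nonneg) ?_ hz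
  obtain ⟨N, hN⟩ := exists_nat_ge |t|
  filter_upwards [Filter.eventually_ge_atTop N] with n hn
  rw [Real.dist_eq]
  apply hL
  have : (N : ℝ) ≤ n := by exact_mod_cast hn
  linarith

theorem aux_scale {X : Type*} {E : (X → ℝ) → ℝ≥0∞} {p : ℝ} (hp : PosHomogeneous p E)
    {C : ℝ → ℝ} (hC : Operates C E) {a : ℝ} (ha : 0 < a) :
    Operates (fun t => a * C (a⁻¹ * t)) E := by
  intro f g
  have h := hC (a⁻¹ • f) (a⁻¹ • g)
  have e0 : (fun t => a * C (a⁻¹ * t)) ∘ g = a • (C ∘ (a⁻¹ • g)) := rfl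
  have hs : ∀ w : X → ℝ, a • a⁻¹ • w = w := fun w => smul_inv_smul₀ ha.ne' w
  have e1 : f + a • (C ∘ (a⁻¹ • g)) = a • (a⁻¹ • f + C ∘ (a⁻¹ • g)) := by
    rw [smul_add, hs]
  have e2 : f - a • (C ∘ (a⁻¹ • g)) = a • (a⁻¹ • f - C ∘ (a⁻¹ • g)) := by
    rw [smul_sub, hs]
  have e3 : f + g = a • (a⁻¹ • f + a⁻¹ • g) := by rw [smul_add, hs, hs]
  have e4 : f - g = a • (a⁻¹ • f - a⁻¹ • g) := by rw [smul_sub, hs, hs]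
  rw [e0, e1, e2, e3, e4, hp a ha.le, hp a ha.le, hp a ha.le, hp a ha.le, ← mul_add, ← mul_add]
  gcongr

/-- **Characterization of compatibility with normal contractions** (Theorem 4.8):
for convex lower semicontinuous `E` with `E 0 = 0`, all normal contractions operate on `E`
iff the family `t ↦ t ∧ α` (`α > 0`) operates, iff the family `t ↦ |t − β| − |β|`
(`β ∈ ℝ`) operates; if `E` is positively `p`-homogeneous, these are further equivalent to
`t ↦ t ∧ 1` operating and to `t ↦ |t − 1| − 1` operating. -/
theorem normal_contraction_characterization {X : Type*} [Nonempty X]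
    (E : (X → ℝ) → ℝ≥0∞)
    (hconv : ConvexENNReal E) (h0 : E 0 = 0) (hlsc : LowerSemicontinuous E) :
    ((∀ C : ℝ → ℝ, LipschitzWith 1 C → C 0 = 0 → Operates C E) ↔
      (∀ α : ℝ, 0 < α → Operates (fun s => min s α) E)) ∧
    ((∀ C : ℝ → ℝ, LipschitzWith 1 C → C 0 = 0 → Operates C E) ↔
      (∀ β : ℝ, Operates (fun s => |s - β| - |β|) E)) ∧
    (∀ p : ℝ, 1 ≤ p → PosHomogeneous p E →
      (((∀ C : ℝ → ℝ, LipschitzWith 1 C → C 0 = 0 → Operates C E) ↔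
          Operates (fun s => min s 1) E) ∧
        ((∀ C : ℝ → ℝ, LipschitzWith 1 C → C 0 = 0 → Operates C E) ↔
          Operates (fun s => |s - 1| - 1) E))) := by
  have hnc : ∀ C : ℝ → ℝ, LipschitzWith 1 C → C 0 = 0 → AuxNC C := by
    intro C hC hC0
    refine ⟨hC0, fun s t => ?_⟩
    have := hC.dist_le_mul s t
    simpa [Real.dist_eq] using this
  have hlip : ∀ C : ℝ → ℝ, (∀ s t, |C s - C t| ≤ |s - t|) → LipschitzWith 1 C := by
    intro C hC
    refine LipschitzWith.of_dist_le_mul fun s t => ?_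
    simpa [Real.dist_eq] using hC s t
  have hgood : AuxGood E → ∀ C : ℝ → ℝ, LipschitzWith 1 C → C 0 = 0 → Operates C E :=
    fun hG C h1 h2 => aux_all hconv hlsc hG (hnc C h1 h2)
  have i_ii : (∀ C : ℝ → ℝ, LipschitzWith 1 C → C 0 = 0 → Operates C E) →
      ∀ α : ℝ, 0 < α → Operates (fun s => min s α) E := by
    intro h α hα
    refine h _ (hlip _ fun s t => ?_) (min_eq_left hα.le)
    have := abs_min_sub_min_le_max s α t α
    simpa using this
  have i_iii : (∀ C : ℝ → ℝ, LipschitzWith 1 C → C 0 = 0 → Operates C E) →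
      ∀ β : ℝ, Operates (fun s => |s - β| - |β|) E := by
    intro h β
    refine h _ (hlip _ fun s t => ?_) (by simp)
    have := abs_abs_sub_abs_le_abs_sub (s - β) (t - β)
    simpa using this
  have hz := tendsto_one_div_add_atTop_nhds_zero_nat (𝕜 := ℝ)
  have ii_good : (∀ α : ℝ, 0 < α → Operates (fun s => min s α) E) → AuxGood E := by
    intro h
    refine aux_good_of_C hlsc fun α hα => ?_
    rcases hα.eq_or_lt with rfl | hα
    · refine aux_operates_lim hlsc (C := fun n s => min s (1 / ((n : ℝ) + 1)))
        (fun n => h _ (by positivity)) (fun t => ?_)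
      exact tendsto_const_nhds.min hz
    · exact h α hα
  have iii_good : (∀ β : ℝ, 0 < β → Operates (fun s => |s - β| - |β|) E) → AuxGood E := by
    intro h
    refine aux_good_of_D fun α hα => ?_
    rcases hα.eq_or_lt with rfl | hα
    · refine aux_operates_lim hlsc
        (C := fun n s => |s - (1 / ((n : ℝ) + 1))| - |1 / ((n : ℝ) + 1)|)
        (fun n => h _ (by positivity)) (fun t => ?_)
      exact (tendsto_const_nhds.sub hz).abs.sub hz.abs
    · exact h α hα
  refine ⟨⟨i_ii, fun h => hgood (ii_good h)⟩, ⟨i_iii, fun h => hgood (iii_good fun β _ => h β)⟩,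
    fun p _ hom => ⟨⟨fun h => i_ii h 1 one_pos, fun h => hgood (ii_good fun α hα => ?_)⟩,
      ⟨fun h => by simpa using i_iii h 1, fun h => hgood (iii_good fun β hβ => ?_)⟩⟩⟩
  · have := aux_scale hom h hα
    convert this using 2 with t
    rw [mul_min_of_nonneg _ _ hα.le, mul_one, mul_inv_cancel_left₀ hα.ne']
  · have := aux_scale hom h hβ
    convert this using 2 with t
    rw [mul_sub, mul_one, abs_of_pos hβ]
    congr 1
    nth_rewrite 2 [← abs_of_pos hβ]
    rw [← abs_mul, mul_sub, mul_one, mul_inv_cancel_left₀ hβ.ne']
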